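/- Let k be any field and let G₂₁ = ⟨σ, τ²⟩ act on the rational function field k(x₀,...,x₆) by σ: xᵢ ↦ x_{i+1 mod 7} and τ²: xᵢ ↦ x_{2i mod 7}. Then k(x₀,...,x₆)^{G₂₁} is purely transcendental over k. -/

import Mathlib

/-- An intermediate field `L` of `E/k` is purely transcendental (rational) over `k`
if `L = k(s)` for some set `s` of elements algebraically independent over `k`. -/
def IsRationalExtension (k : Type*) {E : Type*} [Field k] [Field E] [Algebra k E]
    (L : IntermediateField k E) : Prop :=
  ∃ s : Set E, AlgebraicIndependent k ((↑) : s → E) ∧ IntermediateField.adjoin k s = L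

open IntermediateField Module
open scoped IntermediateField.algebraAdjoinAdjoin

section TranscendenceDegree

variable {k K ι κ : Type*} [Field k] [Field K] [Algebra k K]

theorem algebraicIndependent_of_finiteDimensional_adjoin [Fintype ι] [Fintype κ] {x : ι → K}
    (hx : AlgebraicIndependent k x) {T : κ → K} (hcard : Fintype.card κ = Fintype.card ι)
    [FiniteDimensional (adjoin k (Set.range T)) K] : AlgebraicIndependent k T := by
  have halg : Algebra.IsAlgebraic (Algebra.adjoin k (Set.range T)) K :=
    (IsFractionRing.comap_isAlgebraic_iff (K := adjoin k (Set.range T))).mpr inferInstance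
  refine (Algebra.IsAlgebraic.isTranscendenceBasis_of_lift_le_trdeg_of_finite k T ?_).1
  have h := hx.lift_cardinalMk_le_trdeg
  simpa [hcard] using h

end TranscendenceDegree

section FixedField

variable {k K : Type*} [Field k] [Field K] [Algebra k K] {x : ZMod 7 → K} {σ τ : K ≃ₐ[k] K}

theorem pow_apply_of_shift (hσ : ∀ i, σ (x i) = x (i + 1)) (n : ℕ) (i : ZMod 7) :
    (σ ^ n) (x i) = x (i + n) := by
  induction n with
  | zero => simp
  | succ n ih => rw [pow_succ', AlgEquiv.mul_apply, ih, hσ]; push_cast; ring_nf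

theorem pow_apply_of_double (hτ : ∀ i, τ (x i) = x (2 * i)) (n : ℕ) (i : ZMod 7) :
    (τ ^ n) (x i) = x (2 ^ n * i) := by
  induction n with
  | zero => simp
  | succ n ih => rw [pow_succ', AlgEquiv.mul_apply, ih, hτ]; ring_nf

theorem algEquiv_eq_one_of_adjoin_eq_top (hgen : adjoin k (Set.range x) = ⊤) {g : K ≃ₐ[k] K}
    (hg : ∀ i, g (x i) = x i) : g = 1 := by
  have h : adjoin k (Set.range x) ≤ fixedField (Subgroup.zpowers g) := by
    rw [adjoin_le_iff]
    rintro _ ⟨i, rfl⟩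
    have : Subgroup.zpowers g ≤ MulAction.stabilizer (K ≃ₐ[k] K) (x i) := by
      rw [Subgroup.zpowers_le]
      exact hg i
    exact (mem_fixedField_iff _ _).mpr fun f hf => this hf
  ext y
  exact (mem_fixedField_iff _ _).mp (h (hgen ▸ mem_top)) g (Subgroup.mem_zpowers g)

theorem orderOf_shift (hx : AlgebraicIndependent k x) (hgen : adjoin k (Set.range x) = ⊤)
    (hσ : ∀ i, σ (x i) = x (i + 1)) : orderOf σ = 7 := by
  have hne : (0 : ZMod 7) ≠ 0 + 1 := by decide
  have : Fact (Nat.Prime 7) := ⟨by norm_num⟩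
  refine orderOf_eq_prime (algEquiv_eq_one_of_adjoin_eq_top hgen fun i => ?_) fun h => ?_
  · rw [pow_apply_of_shift hσ, CharP.cast_eq_zero, add_zero]
  · have := hσ 0
    rw [h, AlgEquiv.one_apply] at this
    exact absurd (hx.injective this) hne

theorem orderOf_double (hx : AlgebraicIndependent k x) (hgen : adjoin k (Set.range x) = ⊤)
    (hτ : ∀ i, τ (x i) = x (2 * i)) : orderOf τ = 3 := by
  have hne : (1 : ZMod 7) ≠ 2 * 1 := by decide
  have : Fact (Nat.Prime 3) := ⟨by norm_num⟩
  refine orderOf_eq_prime (algEquiv_eq_one_of_adjoin_eq_top hgen fun i => ?_) fun h => ?_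
  · rw [pow_apply_of_double hτ, show (2 : ZMod 7) ^ 3 = 1 by decide, one_mul]
  · have := hτ 1
    rw [h, AlgEquiv.one_apply] at this
    exact absurd (hx.injective this) hne

theorem isRationalExtension_fixedField (hx : AlgebraicIndependent k x)
    (hgen : adjoin k (Set.range x) = ⊤)
    (hσ : ∀ i, σ (x i) = x (i + 1)) (hτ : ∀ i, τ (x i) = x (2 * i)) (T : Fin 7 → K)
    (hTσ : ∀ i, σ (T i) = T i) (hTτ : ∀ i, τ (T i) = T i)
    [FiniteDimensional (adjoin k (Set.range T)) K]
    (hle : finrank (adjoin k (Set.range T)) K ≤ 21) :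
    IsRationalExtension k (fixedField (Subgroup.closure {σ, τ})) := by
  refine ⟨Set.range T,
    (algebraicIndependent_of_finiteDimensional_adjoin hx (by simp)).to_subtype_range, ?_⟩
  have hsub : adjoin k (Set.range T) ≤ fixedField (Subgroup.closure {σ, τ}) := by
    rw [adjoin_le_iff]
    rintro _ ⟨i, rfl⟩
    have : Subgroup.closure {σ, τ} ≤ MulAction.stabilizer (K ≃ₐ[k] K) (T i) := by
      rw [Subgroup.closure_le]
      rintro _ (rfl | rfl)
      exacts [hTσ i, hTτ i]
    exact (mem_fixedField_iff _ _).mpr fun f hf => this hf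
  have : Finite (adjoin k (Set.range T)).fixingSubgroup :=
    Finite.of_equiv _ (fixingSubgroupEquiv _).symm.toEquiv
  have : Finite (Subgroup.closure {σ, τ}) :=
    Finite.of_injective _ (Subgroup.inclusion_injective ((le_iff_le _ _).mp hsub))
  have := Fintype.ofFinite (Subgroup.closure {σ, τ})
  have hcard : finrank (fixedField (Subgroup.closure {σ, τ})) K
      = Fintype.card (Subgroup.closure {σ, τ}) := FixedPoints.finrank_eq_card _ K
  have h7 : 7 ∣ Fintype.card (Subgroup.closure {σ, τ}) := by
    have := orderOf_dvd_card (x := (⟨σ, Subgroup.subset_closure (by simp)⟩ :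
      Subgroup.closure {σ, τ}))
    rwa [Subgroup.orderOf_mk, orderOf_shift hx hgen hσ] at this
  have h3 : 3 ∣ Fintype.card (Subgroup.closure {σ, τ}) := by
    have := orderOf_dvd_card (x := (⟨τ, Subgroup.subset_closure (by simp)⟩ :
      Subgroup.closure {σ, τ}))
    rwa [Subgroup.orderOf_mk, orderOf_double hx hgen hτ] at this
  have hpos : 0 < Fintype.card (Subgroup.closure {σ, τ}) := Fintype.card_pos
  exact eq_of_le_of_finrank_le' hsub (by omega)

end FixedField

theorem finiteDimensional_and_finrank_le_of_adjoin_simple {F K : Type*} [Field F] [Field K]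
    [Algebra F K] {u : K} {p : Polynomial F} (hp : p.Monic) (hu : Polynomial.aeval u p = 0) :
    FiniteDimensional F F⟮u⟯ ∧ finrank F F⟮u⟯ ≤ p.natDegree := by
  have hint : IsIntegral F u := ⟨p, hp, hu⟩
  refine ⟨adjoin.finiteDimensional hint, ?_⟩
  rw [adjoin.finrank hint]
  exact Polynomial.natDegree_le_of_dvd (minpoly.dvd F u hu) hp.ne_zero

theorem adjoin_eq_top_of_mem {k K ι : Type*} [Field k] [Field K] [Algebra k K] {x : ι → K}
    (hgen : adjoin k (Set.range x) = ⊤) {F : IntermediateField k K} {M : IntermediateField F K}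
    (hM : ∀ i, x i ∈ M) : M = ⊤ := by
  have h : adjoin k (Set.range x) ≤ M.restrictScalars k := by
    rw [adjoin_le_iff]
    rintro _ ⟨i, rfl⟩
    exact hM i
  rw [hgen] at h
  exact eq_top_iff.mpr fun y _ => h mem_top

theorem sum_ne_zero_of_algebraicIndependent {k K ι : Type*} [Fintype ι] [Field k] [Field K]
    [Algebra k K] {x : ι → K} (hx : AlgebraicIndependent k x) (c : ι → k) {i : ι} (hi : c i ≠ 0) :
    ∑ i, algebraMap k K (c i) * x i ≠ 0 := by
  intro h
  simp_rw [← Algebra.smul_def] at h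
  exact hi (Fintype.linearIndependent_iff.mp hx.linearIndependent c h i)

section CharSeven

variable {k K : Type*} [Field k] [Field K] [Algebra k K] [CharP K 7]

local notation "ι" => ZMod.castHom (dvd_refl 7) K

theorem map_zmodCast (g : K ≃ₐ[k] K) (i : ZMod 7) : g (ι i) = ι i :=
  DFunLike.congr_fun (Subsingleton.elim ((g : K →+* K).comp ι) ι) i

theorem isRationalExtension_of_charP_seven [CharP k 7] {x : ZMod 7 → K}
    (hx : AlgebraicIndependent k x) (hgen : adjoin k (Set.range x) = ⊤) {σ τ : K ≃ₐ[k] K}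
    (hσ : ∀ i, σ (x i) = x (i + 1)) (hτ : ∀ i, τ (x i) = x (2 * i)) :
    IsRationalExtension k (fixedField (Subgroup.closure {σ, τ})) := by
  obtain ⟨e₀, he₀⟩ : ∃ e, e = ∑ i, x i := ⟨_, rfl⟩
  obtain ⟨e₁, he₁⟩ : ∃ e, e = ∑ i, ι i * x i := ⟨_, rfl⟩
  obtain ⟨u, hu⟩ : ∃ u, u = e₁ / e₀ := ⟨_, rfl⟩
  obtain ⟨v, hv⟩ : ∃ v : ℕ → K, ∀ j, v j = ∑ i, (u - ι i) ^ j * x i := ⟨_, fun _ => rfl⟩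
  have h7 : (7 : K) = 0 := CharP.cast_eq_zero K 7
  have hbij : Function.Bijective fun i : ZMod 7 => 2 * i := by decide
  have he₀0 : e₀ ≠ 0 := by
    have := sum_ne_zero_of_algebraicIndependent hx (fun _ => 1) (i := 0) one_ne_zero
    simpa [he₀] using this
  have hσu : σ u = u - 1 := by
    have h0 : σ e₀ = e₀ := by
      simp_rw [he₀, map_sum, hσ]
      exact Equiv.sum_comp (Equiv.addRight 1) x
    have h1 : σ e₁ = e₁ - e₀ := by
      simp_rw [he₁, he₀, map_sum, map_mul, map_zmodCast, hσ, ← Finset.sum_sub_distrib]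
      rw [← Equiv.sum_comp (Equiv.addRight 1) fun i => ι i * x i - x i]
      refine Finset.sum_congr rfl fun i _ => ?_
      simp only [Equiv.coe_addRight, map_add, map_one]
      ring
    rw [hu, map_div₀, h0, h1, sub_div, div_self he₀0]
  have hτu : τ u = 4 * u := by
    have h0 : τ e₀ = e₀ := by
      simp_rw [he₀, map_sum, hτ]
      exact Function.Bijective.sum_comp hbij x
    have h1 : τ e₁ = 4 * e₁ := by
      simp_rw [he₁, map_sum, map_mul, map_zmodCast, hτ, Finset.mul_sum]
      rw [← Function.Bijective.sum_comp hbij fun i => 4 * (ι i * x i)]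
      refine Finset.sum_congr rfl fun i _ => ?_
      rw [map_mul, map_ofNat]
      linear_combination (-ι i * x (2 * i)) * h7
    rw [hu, map_div₀, h0, h1, mul_div_assoc]
  have hσv (j : ℕ) : σ (v j) = v j := by
    simp_rw [hv, map_sum, map_mul, map_pow, map_sub, map_zmodCast, hσ, hσu]
    rw [← Equiv.sum_comp (Equiv.addRight 1) fun i => (u - ι i) ^ j * x i]
    refine Finset.sum_congr rfl fun i _ => ?_
    simp only [Equiv.coe_addRight, map_add, map_one]
    ring
  have hτv (j : ℕ) : τ (v j) = 4 ^ j * v j := by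
    simp_rw [hv, map_sum, map_mul, map_pow, map_sub, map_zmodCast, hτ, hτu, Finset.mul_sum]
    rw [← Function.Bijective.sum_comp hbij fun i => 4 ^ j * ((u - ι i) ^ j * x i)]
    refine Finset.sum_congr rfl fun i _ => ?_
    rw [← mul_assoc, ← mul_pow, map_mul, map_ofNat]
    congr 2
    linear_combination ι i * h7
  have hu7 : u ^ 7 - u ≠ 0 := by
    have hne (i : ZMod 7) : u - ι i ≠ 0 := by
      have h0 := sum_ne_zero_of_algebraicIndependent hx
        (fun j => ZMod.castHom (dvd_refl 7) k (j - i)) (i := i + 1) (by simp)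
      have hι (j : ZMod 7) : algebraMap k K (ZMod.castHom (dvd_refl 7) k j) = ι j :=
        DFunLike.congr_fun
          (Subsingleton.elim ((algebraMap k K).comp (ZMod.castHom (dvd_refl 7) k)) ι) j
      simp_rw [hι, map_sub, sub_mul, Finset.sum_sub_distrib, ← Finset.mul_sum, ← he₀, ← he₁]
        at h0
      rw [hu, div_sub' he₀0]
      exact div_ne_zero (by rwa [mul_comm]) he₀0
    have h := Finset.prod_ne_zero_iff.mpr fun i (_ : i ∈ Finset.univ) => hne i
    have hprod : ∏ i, (u - ι i) = u ^ 7 - u := by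
      have hfin : ∏ i, (u - ι i) =
          (u - ι 0) * (u - ι 1) * (u - ι 2) * (u - ι 3) * (u - ι 4) * (u - ι 5) * (u - ι 6) :=
        Fin.prod_univ_seven fun i : Fin 7 => u - ι i
      have h2 : ι 2 = 2 := map_ofNat _ 2
      have h3 : ι 3 = 3 := map_ofNat _ 3
      have h4 : ι 4 = 4 := map_ofNat _ 4
      have h5 : ι 5 = 5 := map_ofNat _ 5
      have h6 : ι 6 = 6 := map_ofNat _ 6
      rw [hfin, map_zero, map_one, h2, h3, h4, h5, h6]
      linear_combination (-3 * u ^ 6 + 25 * u ^ 5 - 105 * u ^ 4 + 232 * u ^ 3 - 252 * u ^ 2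
        + 103 * u) * h7
    exact hprod ▸ h
  have hx_eq (j : ZMod 7) : x j = v 0 -
      ∑ m ∈ Finset.range 7, (u - ι j) ^ m * (-1) ^ (6 - m) * (Nat.choose 6 m) * v (6 - m) := by
    have h1 : ∀ i j : ZMod 7, (i - j) ^ 6 = if i = j then 0 else 1 := by decide
    have h2 (i : ZMod 7) : ∑ m ∈ Finset.range 7, (u - ι j) ^ m * (-1) ^ (6 - m) *
        (Nat.choose 6 m) * (u - ι i) ^ (6 - m) = if i = j then 0 else 1 := by
      have := congrArg ι (h1 i j)
      rw [map_pow, map_sub, show ι i - ι j = (u - ι j) + -1 * (u - ι i) by ring, add_pow] at this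
      rw [apply_ite ι, map_zero, map_one] at this
      rw [← this]
      refine Finset.sum_congr rfl fun m _ => ?_
      rw [mul_pow]
      ring
    simp_rw [hv, Finset.mul_sum]
    rw [Finset.sum_comm]
    simp_rw [← mul_assoc, ← Finset.sum_mul, h2, pow_zero, ← Finset.sum_sub_distrib, ← sub_mul]
    rw [Finset.sum_eq_single j (fun i _ hi => by simp [hi]) (by simp)]
    simp
  let T : Fin 7 → K := ![v 0, (u ^ 7 - u) ^ 3, v 3, v 6, v 2 * (u ^ 7 - u), v 5 * (u ^ 7 - u),
    v 4 * (u ^ 7 - u) ^ 2]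
  let F := adjoin k (Set.range T)
  have hTF (i : Fin 7) : T i ∈ F := subset_adjoin k _ ⟨i, rfl⟩
  have hTM (i : Fin 7) : T i ∈ F⟮u⟯ := _root_.algebraMap_mem F⟮u⟯ (⟨T i, hTF i⟩ : F)
  have huM : u ∈ F⟮u⟯ := mem_adjoin_simple_self F u
  have hcM (i : ZMod 7) : u - ι i ∈ F⟮u⟯ := by
    rw [ZMod.castHom_apply, ← ZMod.natCast_val]
    exact sub_mem huM (_root_.natCast_mem _ _)
  have hN : u ^ 7 - u ∈ F⟮u⟯ := sub_mem (pow_mem huM 7) huM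
  have hv1 : v 1 = 0 := by
    simp_rw [hv, pow_one, sub_mul, Finset.sum_sub_distrib, ← Finset.mul_sum, ← he₀, ← he₁, hu]
    rw [div_mul_cancel₀ _ he₀0, sub_self]
  have hvM (j : ℕ) (hj : j < 7) : v j ∈ F⟮u⟯ := by
    interval_cases j
    · exact hTM 0
    · exact hv1 ▸ zero_mem _
    · exact (mul_div_cancel_right₀ (v 2) hu7) ▸ div_mem (hTM 4) hN
    · exact hTM 2
    · exact (mul_div_cancel_right₀ (v 4) (pow_ne_zero 2 hu7)) ▸ div_mem (hTM 6) (pow_mem hN 2)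
    · exact (mul_div_cancel_right₀ (v 5) hu7) ▸ div_mem (hTM 5) hN
    · exact hTM 3
  have htop : F⟮u⟯ = ⊤ := by
    refine adjoin_eq_top_of_mem hgen fun j => ?_
    rw [hx_eq]
    refine sub_mem (hvM 0 (by norm_num)) (sum_mem fun m _ => ?_)
    exact mul_mem (mul_mem (mul_mem (pow_mem (hcM j) m) (pow_mem (neg_mem (one_mem _)) _))
      (_root_.natCast_mem _ _)) (hvM _ (by omega))
  obtain ⟨hfin, hle⟩ := finiteDimensional_and_finrank_le_of_adjoin_simple (u := u)
    (p := (Polynomial.X ^ 7 - Polynomial.X) ^ 3 - Polynomial.C (⟨T 1, hTF 1⟩ : F))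
    (by monicity!) (by simp [T])
  have hdeg : ((Polynomial.X ^ 7 - Polynomial.X) ^ 3 -
      Polynomial.C (⟨T 1, hTF 1⟩ : F)).natDegree ≤ 21 := by compute_degree
  rw [htop] at hfin hle
  have : FiniteDimensional F K := topEquiv.toLinearEquiv.finiteDimensional
  rw [finrank_top'] at hle
  refine isRationalExtension_fixedField hx hgen hσ hτ T (fun i => ?_) (fun i => ?_)
    (hle.trans hdeg)
  · have hσN : σ (u ^ 7 - u) = u ^ 7 - u := by
      rw [map_sub, map_pow, hσu]
      linear_combination (-u ^ 6 + 3 * u ^ 5 - 5 * u ^ 4 + 5 * u ^ 3 - 3 * u ^ 2 + u) * h7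
    fin_cases i <;> simp [T, hσv, -map_sub, hσN]
  · have hτN : τ (u ^ 7 - u) = 4 * (u ^ 7 - u) := by
      rw [map_sub, map_pow, hτu]
      linear_combination (2340 * u ^ 7) * h7
    fin_cases i <;> simp [T, hτv, -map_sub, hτN]
    · linear_combination 9 * (u ^ 7 - u) ^ 3 * h7
    · linear_combination 9 * v 3 * h7
    · linear_combination 585 * v 6 * h7
    · linear_combination 9 * v 2 * (u ^ 7 - u) * h7
    · linear_combination 585 * v 5 * (u ^ 7 - u) * h7
    · linear_combination 585 * v 4 * (u ^ 7 - u) ^ 2 * h7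

end CharSeven

section CharacterAlgebra

variable {A Ω : Type*} [CommRing A] [Field Ω]

/-- The `F`-algebra of functions on `A` spanned by the characters `a ↦ ψ (a * j)`. -/
def characterAlgebra (F : Type*) [Field F] [Algebra F Ω] (ψ : AddChar A Ω) :
    Subalgebra F (A → Ω) :=
  Algebra.adjoin F (Set.range fun j a => ψ (a * j))

variable {F : Type*} [Field F] [Algebra F Ω] {ψ : AddChar A Ω}

theorem toSubmodule_characterAlgebra :
    Subalgebra.toSubmodule (characterAlgebra F ψ)
      = Submodule.span F (Set.range fun j a => ψ (a * j)) := by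
  let χ : Multiplicative A →* (A → Ω) :=
    { toFun := fun j a => ψ (a * j.toAdd)
      map_one' := by ext; simp
      map_mul' := fun i j => by ext; simp [mul_add, AddChar.map_add_eq_mul] }
  have hχ : (Set.range fun j a => ψ (a * j)) = (MonoidHom.mrange χ : Set (A → Ω)) := rfl
  rw [characterAlgebra, Algebra.adjoin_eq_span, hχ, Submonoid.closure_eq]

variable [Fintype A]

theorem mem_characterAlgebra_iff {f : A → Ω} :
    f ∈ characterAlgebra F ψ ↔ ∃ e : A → F, ∀ a, f a = ∑ j, algebraMap F Ω (e j) * ψ (a * j) := by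
  rw [← Subalgebra.mem_toSubmodule, toSubmodule_characterAlgebra,
    Submodule.mem_span_range_iff_exists_fun]
  refine exists_congr fun e => ?_
  rw [eq_comm, funext_iff]
  simp [Algebra.smul_def]

theorem inv_mem_characterAlgebra {f : A → Ω} (hf : f ∈ characterAlgebra F ψ)
    (h0 : ∀ a, f a ≠ 0) : f⁻¹ ∈ characterAlgebra F ψ := by
  have : FiniteDimensional F (Subalgebra.toSubmodule (characterAlgebra F ψ)) := by
    rw [toSubmodule_characterAlgebra]
    exact FiniteDimensional.span_of_finite F (Set.finite_range _)
  have : FiniteDimensional F (characterAlgebra F ψ) := this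
  have hinj : Function.Injective (LinearMap.mulLeft F (⟨f, hf⟩ : characterAlgebra F ψ)) := by
    intro g h hgh
    ext a
    exact mul_left_cancel₀ (h0 a) (congr_fun (congrArg Subtype.val hgh) a)
  obtain ⟨g, hg⟩ := LinearMap.injective_iff_surjective.mp hinj 1
  have hgf : f⁻¹ = g := by
    ext a
    exact inv_eq_of_mul_eq_one_right (congr_fun (congrArg Subtype.val hg) a)
  exact hgf ▸ g.2

theorem comp_mul_mem_characterAlgebra {f : A → Ω} (hf : f ∈ characterAlgebra F ψ) (u : A) :
    (fun a => f (u * a)) ∈ characterAlgebra F ψ := by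
  obtain ⟨e, he⟩ := mem_characterAlgebra_iff.mp hf
  have : (fun a => f (u * a)) = ∑ j, e j • fun a => ψ (a * (u * j)) := by
    ext a
    simp only [he, Finset.sum_apply, Pi.smul_apply]
    exact Finset.sum_congr rfl fun j _ => by rw [Algebra.smul_def, mul_comm u, mul_assoc]
  rw [this]
  exact sum_mem fun j _ => Subalgebra.smul_mem _
    (Algebra.subset_adjoin (Set.mem_range_self (u * j))) _

theorem sum_mul_mem_range_algebraMap [DecidableEq A] (hψ : ψ.IsPrimitive) {f : A → Ω}
    (hf : f ∈ characterAlgebra F ψ) (j : A) :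
    ∑ a, ψ (-(a * j)) * f a ∈ Set.range (algebraMap F Ω) := by
  obtain ⟨e, he⟩ := mem_characterAlgebra_iff.mp hf
  refine ⟨Fintype.card A * e j, ?_⟩
  have (a m : A) : ψ (-(a * j)) * (algebraMap F Ω (e m) * ψ (a * m))
      = algebraMap F Ω (e m) * ψ (a * (m - j)) := by
    rw [mul_left_comm, ← AddChar.map_add_eq_mul]
    ring_nf
  simp_rw [he, Finset.mul_sum, this]
  rw [Finset.sum_comm]
  simp_rw [← Finset.mul_sum, AddChar.sum_mulShift _ hψ, sub_eq_zero]
  simp [mul_comm]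

theorem eq_sum_inversion [DecidableEq A] (hψ : ψ.IsPrimitive) (f : A → Ω) (a : A) :
    Fintype.card A * f a = ∑ j, (∑ b, ψ (-(b * j)) * f b) * ψ (a * j) := by
  have (j b : A) : ψ (-(b * j)) * f b * ψ (a * j) = ψ (j * (a - b)) * f b := by
    rw [mul_right_comm, ← AddChar.map_add_eq_mul]
    ring_nf
  simp_rw [Finset.sum_mul, this]
  rw [Finset.sum_comm]
  simp_rw [← Finset.sum_mul, AddChar.sum_mulShift _ hψ, sub_eq_zero]
  simp

theorem mem_characterAlgebra_of_sum_mem [DecidableEq A] (hψ : ψ.IsPrimitive)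
    (hcard : (Fintype.card A : Ω) ≠ 0) {f : A → Ω}
    (hf : ∀ j, ∑ a, ψ (-(a * j)) * f a ∈ Set.range (algebraMap F Ω)) :
    f ∈ characterAlgebra F ψ := by
  choose e he using hf
  refine mem_characterAlgebra_iff.mpr ⟨fun j => (Fintype.card A : F)⁻¹ * e j, fun a => ?_⟩
  simp_rw [map_mul, map_inv₀, map_natCast, he, mul_assoc, ← Finset.mul_sum,
    ← eq_sum_inversion hψ f a]
  rw [inv_mul_cancel_left₀ hcard]

end CharacterAlgebra

section Resolvents

variable {Ω : Type*} [Field Ω] (ψ : AddChar (ZMod 7) Ω) (X : ZMod 7 → Ω)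

/-- The Lagrange resolvents of `X`. -/
def lagrangeSum (a : ZMod 7) : Ω := ∑ j, ψ (a * j) * X j

/-- Products of Lagrange resolvents that are invariant under cyclic shifts of `X`. -/
def resolventRatio (a : ZMod 7) : Ω :=
  lagrangeSum ψ X a * lagrangeSum ψ X (3 * a) / lagrangeSum ψ X (4 * a)

/-- The inverse Fourier transform, up to the factor `7`, of `resolventRatio`. -/
def ratioTransform (j : ZMod 7) : Ω := ∑ a, ψ (-(a * j)) * resolventRatio ψ X a

variable {ψ X}

theorem map_lagrangeSum {φ : Ω →+* Ω} {r u u' d : ZMod 7} (huu' : u' * u = 1)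
    (hψ : ∀ t, φ (ψ t) = ψ (r * t)) (hX : ∀ j, φ (X j) = X (u * j + d)) (a : ZMod 7) :
    φ (lagrangeSum ψ X a) = ψ (-(r * u' * a * d)) * lagrangeSum ψ X (r * u' * a) := by
  have hbij : Function.Bijective fun j => u * j + d :=
    Finite.injective_iff_bijective.mp fun i j hij => by
      linear_combination u' * hij - (i - j) * huu'
  simp_rw [lagrangeSum, map_sum, map_mul, hψ, hX, Finset.mul_sum]
  rw [← hbij.sum_comp fun j => ψ (-(r * u' * a * d)) * (ψ (r * u' * a * j) * X j)]
  refine Finset.sum_congr rfl fun j _ => ?_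
  rw [← mul_assoc (ψ _), ← AddChar.map_add_eq_mul]
  congr 2
  linear_combination (-r * a * j) * huu'

theorem map_resolventRatio {φ : Ω →+* Ω} {r u u' d : ZMod 7} (huu' : u' * u = 1)
    (hψ : ∀ t, φ (ψ t) = ψ (r * t)) (hX : ∀ j, φ (X j) = X (u * j + d)) (a : ZMod 7) :
    φ (resolventRatio ψ X a) = resolventRatio ψ X (r * u' * a) := by
  have hψ0 (t : ZMod 7) : ψ t ≠ 0 := (ψ.val_isUnit t).ne_zero
  simp_rw [resolventRatio, map_div₀, map_mul, map_lagrangeSum huu' hψ hX]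
  rw [mul_mul_mul_comm, ← AddChar.map_add_eq_mul,
    show -(r * u' * a * d) + -(r * u' * (3 * a) * d) = -(r * u' * (4 * a) * d) by ring,
    mul_div_mul_left _ _ (hψ0 _)]
  simp only [mul_left_comm]

theorem map_ratioTransform {φ : Ω →+* Ω} {r r' u u' d : ZMod 7} (huu' : u' * u = 1)
    (hrr' : r' * r = 1)
    (hψ : ∀ t, φ (ψ t) = ψ (r * t)) (hX : ∀ j, φ (X j) = X (u * j + d)) (j : ZMod 7) :
    φ (ratioTransform ψ X j) = ratioTransform ψ X (u * j) := by
  have hbij : Function.Bijective fun j => r * u' * j :=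
    Finite.injective_iff_bijective.mp fun i j hij => by
      linear_combination r' * u * hij - (i - j) * r' * r * huu' - (i - j) * hrr'
  simp_rw [ratioTransform, map_sum, map_mul, hψ, map_resolventRatio huu' hψ hX]
  rw [← hbij.sum_comp fun a => ψ (-(a * (u * j))) * resolventRatio ψ X a]
  refine Finset.sum_congr rfl fun a _ => ?_
  congr 2
  linear_combination (r * a * j) * huu'

theorem lagrangeSum_ne_zero {k : Type*} [Field k] [Algebra k Ω] (hX : AlgebraicIndependent k X)
    (a : ZMod 7) : lagrangeSum ψ X a ≠ 0 := by
  have hint (t : ZMod 7) : IsIntegral k (ψ t) := by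
    refine IsIntegral.of_pow (n := 7) (by norm_num) ?_
    rw [← AddChar.map_nsmul_eq_pow, show 7 • t = 0 by revert t; decide, AddChar.map_zero_eq_one]
    exact isIntegral_one
  have hX' : AlgebraicIndependent (algebraicClosure k Ω) X := hX.extendScalars _
  have h0 : (⟨ψ (a * 0), mem_algebraicClosure_iff.mpr (hint _).isAlgebraic⟩ :
      algebraicClosure k Ω) ≠ 0 := by
    rw [Ne, ← ZeroMemClass.coe_eq_zero]
    exact (ψ.val_isUnit _).ne_zero
  exact sum_ne_zero_of_algebraicIndependent hX'
    (fun j => ⟨ψ (a * j), mem_algebraicClosure_iff.mpr (hint _).isAlgebraic⟩) (i := 0) h0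

section Span

variable {F : Type*} [Field F] [Algebra F Ω]

theorem resolventRatio_mem_characterAlgebra (hX : ∀ i, X i ∈ Set.range (algebraMap F Ω))
    (hy : ∀ a, lagrangeSum ψ X a ≠ 0) : resolventRatio ψ X ∈ characterAlgebra F ψ := by
  have hmem : lagrangeSum ψ X ∈ characterAlgebra F ψ := by
    choose e he using hX
    refine mem_characterAlgebra_iff.mpr ⟨e, fun a => Finset.sum_congr rfl fun j _ => ?_⟩
    rw [he, mul_comm]
  convert mul_mem (mul_mem hmem (comp_mul_mem_characterAlgebra hmem 3))
    (inv_mem_characterAlgebra (comp_mul_mem_characterAlgebra hmem 4) fun a => hy _) using 1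
  ext a
  simp [resolventRatio, div_eq_mul_inv]

theorem exists_lagrangeSum_mul_eq (hy : ∀ a, lagrangeSum ψ X a ≠ 0)
    (hz : resolventRatio ψ X ∈ characterAlgebra F ψ) (b : ZMod 7) :
    ∃ c ∈ characterAlgebra F ψ, ∀ a, lagrangeSum ψ X a * lagrangeSum ψ X (a * b)
      = c a * lagrangeSum ψ X (a * (1 + b)) := by
  refine ⟨fun a => lagrangeSum ψ X a * lagrangeSum ψ X (a * b) / lagrangeSum ψ X (a * (1 + b)), ?_,
    fun a => (div_mul_cancel₀ _ (hy _)).symm⟩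
  have hzu (u : ZMod 7) : (fun a => resolventRatio ψ X (u * a)) ∈ characterAlgebra F ψ :=
    comp_mul_mem_characterAlgebra hz u
  have hzi (u : ZMod 7) : (fun a => resolventRatio ψ X (u * a))⁻¹ ∈ characterAlgebra F ψ :=
    inv_mem_characterAlgebra (hzu u) fun a => div_ne_zero (mul_ne_zero (hy _) (hy _)) (hy _)
  have key (u v w : ZMod 7) (h : ∀ Y : ZMod 7 → Ω, (∀ n, Y n ≠ 0) → Y 1 * Y b / Y (1 + b) =
        Y u * Y (3 * u) / Y (4 * u) * (Y v * Y (3 * v) / Y (4 * v))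
          * (Y w * Y (3 * w) / Y (4 * w))⁻¹) :
      (fun a => lagrangeSum ψ X a * lagrangeSum ψ X (a * b) / lagrangeSum ψ X (a * (1 + b)))
        ∈ characterAlgebra F ψ := by
    convert mul_mem (mul_mem (hzu u) (hzu v)) (hzi w) using 1
    ext a
    have := h (fun n => lagrangeSum ψ X (n * a)) fun n => hy _
    simpa [resolventRatio, mul_assoc, mul_comm a] using this
  fin_cases b
  · refine key 0 0 0 fun Y hY => ?_
    change Y 1 * Y 0 / Y 1 = Y 0 * Y 0 / Y 0 * (Y 0 * Y 0 / Y 0) * (Y 0 * Y 0 / Y 0)⁻¹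
    field_simp [hY]
  · refine key 1 6 2 fun Y hY => ?_
    change Y 1 * Y 1 / Y 2 = Y 1 * Y 3 / Y 4 * (Y 6 * Y 4 / Y 3) * (Y 2 * Y 6 / Y 1)⁻¹
    field_simp [hY]
  · refine key 5 6 4 fun Y hY => ?_
    change Y 1 * Y 2 / Y 3 = Y 5 * Y 1 / Y 6 * (Y 6 * Y 4 / Y 3) * (Y 4 * Y 5 / Y 2)⁻¹
    field_simp [hY]
  · refine key 1 0 0 fun Y hY => ?_
    change Y 1 * Y 3 / Y 4 = Y 1 * Y 3 / Y 4 * (Y 0 * Y 0 / Y 0) * (Y 0 * Y 0 / Y 0)⁻¹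
    field_simp [hY]
  · refine key 3 6 2 fun Y hY => ?_
    change Y 1 * Y 4 / Y 5 = Y 3 * Y 2 / Y 5 * (Y 6 * Y 4 / Y 3) * (Y 2 * Y 6 / Y 1)⁻¹
    field_simp [hY]
  · refine key 5 0 0 fun Y hY => ?_
    change Y 1 * Y 5 / Y 6 = Y 5 * Y 1 / Y 6 * (Y 0 * Y 0 / Y 0) * (Y 0 * Y 0 / Y 0)⁻¹
    field_simp [hY]
  · refine key 1 6 0 fun Y hY => ?_
    change Y 1 * Y 6 / Y 0 = Y 1 * Y 3 / Y 4 * (Y 6 * Y 4 / Y 3) * (Y 0 * Y 0 / Y 0)⁻¹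
    field_simp [hY]

theorem sum_mul_lagrangeSum_mem_span (hψ : ψ.IsPrimitive) {f : ZMod 7 → Ω}
    (hf : f ∈ characterAlgebra F ψ) (u : ZMod 7) :
    ∑ a, f a * lagrangeSum ψ X (a * u) ∈ Submodule.span F (Set.range X) := by
  obtain ⟨e, he⟩ := mem_characterAlgebra_iff.mp hf
  have h (a : ZMod 7) : f a * lagrangeSum ψ X (a * u)
      = ∑ m, ∑ j, ψ (a * (m + u * j)) * (algebraMap F Ω (e m) * X j) := by
    rw [he, lagrangeSum, Finset.sum_mul_sum]
    refine Finset.sum_congr rfl fun m _ => Finset.sum_congr rfl fun j _ => ?_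
    rw [mul_add, AddChar.map_add_eq_mul, mul_assoc a]
    ring
  simp_rw [h]
  rw [Finset.sum_comm]
  refine sum_mem fun m _ => ?_
  rw [Finset.sum_comm]
  refine sum_mem fun j _ => ?_
  rw [← Finset.sum_mul, AddChar.sum_mulShift _ hψ, ← Algebra.smul_def]
  have hX : e m • X j ∈ Submodule.span F (Set.range X) :=
    Submodule.smul_mem _ _ (Submodule.subset_span ⟨j, rfl⟩)
  split_ifs
  · rw [← nsmul_eq_mul]
    exact nsmul_mem hX _
  · rw [Nat.cast_zero, zero_mul]
    exact zero_mem _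

theorem lagrangeSum_zero : lagrangeSum ψ X 0 = ∑ j, X j := by
  simp [lagrangeSum]

theorem lagrangeSum_zero_mem_range
    (hz : resolventRatio ψ X ∈ characterAlgebra F ψ) :
    lagrangeSum ψ X 0 ∈ Set.range (algebraMap F Ω) := by
  obtain ⟨e, he⟩ := mem_characterAlgebra_iff.mp hz
  refine ⟨∑ j, e j, ?_⟩
  have h := he 0
  simp only [resolventRatio, mul_zero, zero_mul, AddChar.map_zero_eq_one, mul_one,
    ← map_sum] at h
  rw [← h, mul_self_div_self]

theorem sum_mul_lagrangeSum (hψ : ψ.IsPrimitive) (i : ZMod 7) :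
    ∑ a, ψ (-(a * i)) * lagrangeSum ψ X a = 7 * X i := by
  have h (a j : ZMod 7) : ψ (-(a * i)) * (ψ (a * j) * X j) = ψ (a * (j - i)) * X j := by
    rw [← mul_assoc, ← AddChar.map_add_eq_mul]
    ring_nf
  simp_rw [lagrangeSum, Finset.mul_sum, h]
  rw [Finset.sum_comm]
  simp_rw [← Finset.sum_mul, AddChar.sum_mulShift _ hψ, sub_eq_zero]
  simp

theorem mul_mem_span_of_resolventRatio_mem (hψ : ψ.IsPrimitive) (h7 : (7 : F) ≠ 0)
    (hy : ∀ a, lagrangeSum ψ X a ≠ 0) (hz : resolventRatio ψ X ∈ characterAlgebra F ψ)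
    (i j : ZMod 7) : X i * X j ∈ Submodule.span F (Set.range X) := by
  have hunit : ∀ a : ZMod 7, a ≠ 0 → ∃ a', a' * a = 1 := by decide
  obtain ⟨s, hs⟩ := lagrangeSum_zero_mem_range hz
  obtain ⟨c, hcmem, hc⟩ : ∃ c : ZMod 7 → ZMod 7 → Ω, (∀ b, c b ∈ characterAlgebra F ψ) ∧
      ∀ b a, lagrangeSum ψ X a * lagrangeSum ψ X (a * b)
        = c b a * lagrangeSum ψ X (a * (1 + b)) := by
    choose c h1 h2 using exists_lagrangeSum_mul_eq hy hz
    exact ⟨c, h1, h2⟩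
  have hχ (m : ZMod 7) : (fun a => ψ (a * m)) ∈ characterAlgebra F ψ :=
    Algebra.subset_adjoin ⟨m, rfl⟩
  have hXW (m : ZMod 7) : X m ∈ Submodule.span F (Set.range X) :=
    Submodule.subset_span ⟨m, rfl⟩
  let G (a : ZMod 7) : Ω :=
    ψ (-(a * i)) * lagrangeSum ψ X a * ∑ b, ψ (-(b * j)) * lagrangeSum ψ X b
  let H (a : ZMod 7) : Ω :=
    ∑ b, ψ (a * -(i + b * j)) * (lagrangeSum ψ X a * lagrangeSum ψ X (a * b))
  have hGH (a : ZMod 7) (ha : a ≠ 0) : G a = H a := by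
    obtain ⟨a', ha'⟩ := hunit a ha
    have hbij : Function.Bijective fun b => a * b :=
      Finite.injective_iff_bijective.mp fun b b' hb => by
        linear_combination a' * hb - (b - b') * ha'
    simp only [G, H]
    rw [← hbij.sum_comp, Finset.mul_sum]
    refine Finset.sum_congr rfl fun b _ => ?_
    rw [show a * -(i + b * j) = -(a * i) + -(a * b * j) by ring, AddChar.map_add_eq_mul]
    ring
  have hH : ∑ a, H a ∈ Submodule.span F (Set.range X) := by
    simp only [H]
    rw [Finset.sum_comm]
    refine sum_mem fun b _ => ?_
    simp_rw [hc, ← mul_assoc]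
    exact sum_mul_lagrangeSum_mem_span hψ (mul_mem (hχ _) (hcmem b)) (1 + b)
  have hG0 : G 0 = (7 * s) • X j := by
    simp only [G, sum_mul_lagrangeSum hψ]
    rw [zero_mul, neg_zero, AddChar.map_zero_eq_one, ← hs, Algebra.smul_def, map_mul, map_ofNat]
    ring
  have hH0 : H 0 = (7 * s) • ∑ m, X m := by
    rw [← lagrangeSum_zero (ψ := ψ), Algebra.smul_def, map_mul, map_ofNat]
    simp only [H, zero_mul, AddChar.map_zero_eq_one, ← hs]
    simp [mul_assoc]
  have hsum : ∑ a, G a = ∑ a, H a - H 0 + G 0 := by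
    rw [← Finset.add_sum_erase _ G (Finset.mem_univ 0),
      ← Finset.add_sum_erase _ H (Finset.mem_univ 0),
      Finset.sum_congr rfl fun a ha => hGH a (Finset.ne_of_mem_erase ha)]
    ring
  have hXX : X i * X j = (7 * 7 : F)⁻¹ • ∑ a, G a := by
    have h49 : algebraMap F Ω (7 * 7) ≠ 0 := by
      simpa using h7
    simp only [G]
    rw [← Finset.sum_mul, sum_mul_lagrangeSum hψ, sum_mul_lagrangeSum hψ, Algebra.smul_def,
      map_inv₀, eq_inv_mul_iff_mul_eq₀ h49, map_mul, map_ofNat]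
    ring
  rw [hXX, hsum, hG0, hH0]
  exact Submodule.smul_mem _ _ (add_mem (sub_mem hH (Submodule.smul_mem _ _
    (sum_mem fun m _ => hXW m))) (Submodule.smul_mem _ _ (hXW j)))

theorem one_mem_span_of_resolventRatio_mem
    (hy : ∀ a, lagrangeSum ψ X a ≠ 0) (hz : resolventRatio ψ X ∈ characterAlgebra F ψ) :
    (1 : Ω) ∈ Submodule.span F (Set.range X) := by
  obtain ⟨s, hs⟩ := lagrangeSum_zero_mem_range hz
  have h1 : (1 : Ω) = s⁻¹ • ∑ j, X j := by
    rw [← lagrangeSum_zero (ψ := ψ), Algebra.smul_def, map_inv₀, hs, inv_mul_cancel₀ (hy 0)]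
  rw [h1]
  exact Submodule.smul_mem _ _ (sum_mem fun j _ => Submodule.subset_span ⟨j, rfl⟩)

end Span

theorem finiteDimensional_and_finrank_le_of_mul_mem_span {k K ι : Type*} [Fintype ι] [Field k]
    [Field K] [Algebra k K] {x : ι → K} (hgen : adjoin k (Set.range x) = ⊤)
    {L : IntermediateField k K} (h1 : (1 : K) ∈ Submodule.span L (Set.range x))
    (hmul : ∀ i j, x i * x j ∈ Submodule.span L (Set.range x)) :
    FiniteDimensional L K ∧ finrank L K ≤ Fintype.card ι := by
  let S : Subalgebra L K := (Submodule.span L (Set.range x)).toSubalgebra h1 <| by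
    intro a b ha hb
    have hab := Submodule.mul_mem_mul ha hb
    rw [Submodule.span_mul_span] at hab
    refine Submodule.span_le.mpr ?_ hab
    rintro _ ⟨_, ⟨i, rfl⟩, _, ⟨j, rfl⟩, rfl⟩
    exact hmul i j
  have hSfin : FiniteDimensional L S :=
    FiniteDimensional.span_of_finite L (Set.finite_range x)
  let M : IntermediateField L K := S.toIntermediateField'
    (isField_of_isIntegral_of_isField' (Field.toIsField L))
  have hM : M = ⊤ := adjoin_eq_top_of_mem hgen fun i => Submodule.subset_span ⟨i, rfl⟩
  have htop : Submodule.span L (Set.range x) = ⊤ :=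
    eq_top_iff.mpr fun y _ => (hM ▸ mem_top : y ∈ M)
  refine ⟨⟨(Submodule.fg_def.mpr ⟨_, Set.finite_range x, htop⟩)⟩, ?_⟩
  have h := finrank_range_le_card (R := L) x
  rwa [Set.finrank, htop, finrank_top] at h

theorem finiteDimensional_and_finrank_le_of_ratioTransform_mem {k K : Type*} [Field k] [Field K]
    [Algebra k K] [Algebra K Ω] (hψ : ψ.IsPrimitive) (h7 : (7 : K) ≠ 0) {x : ZMod 7 → K}
    (hgen : adjoin k (Set.range x) = ⊤)
    (hy : ∀ a, lagrangeSum ψ (fun i => algebraMap K Ω (x i)) a ≠ 0) {L : IntermediateField k K}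
    {w : ZMod 7 → K} (hwL : ∀ j, w j ∈ L)
    (hw : ∀ j, algebraMap K Ω (w j) = ratioTransform ψ (fun i => algebraMap K Ω (x i)) j) :
    FiniteDimensional L K ∧ finrank L K ≤ 7 := by
  have h7L : (7 : L) ≠ 0 := fun h => h7 (congrArg (algebraMap L K) h)
  have h7Ω : (7 : Ω) ≠ 0 := fun h => h7 <| (algebraMap K Ω).injective <| by
    rw [map_ofNat, h, map_zero]
  have hz : resolventRatio ψ (fun i => algebraMap K Ω (x i)) ∈ characterAlgebra L ψ :=
    mem_characterAlgebra_of_sum_mem hψ (by simpa using h7Ω) fun j => ⟨⟨w j, hwL j⟩, hw j⟩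
  have hmem (a : K) : algebraMap K Ω a ∈ Submodule.span L (Set.range fun i => algebraMap K Ω (x i))
      ↔ a ∈ Submodule.span L (Set.range x) := by
    let φ : K →ₗ[L] Ω := (IsScalarTower.toAlgHom L K Ω).toLinearMap
    have hφ : Function.Injective φ := (algebraMap K Ω).injective
    rw [show (Set.range fun i => algebraMap K Ω (x i)) = φ '' Set.range x from
      Set.range_comp (algebraMap K Ω) x, ← Submodule.map_span]
    exact hφ.mem_set_image
  refine finiteDimensional_and_finrank_le_of_mul_mem_span hgen ((hmem 1).mp ?_)
    fun i j => (hmem _).mp ?_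
  · rw [map_one]
    exact one_mem_span_of_resolventRatio_mem hy hz
  · rw [map_mul]
    exact mul_mem_span_of_resolventRatio_mem hψ h7L hy hz i j

end Resolvents

section ShiftInvariants

variable {k K : Type*} [Field k] [Field K] [Algebra k K]

theorem exists_ringHom_algebraMap_algebraicClosure (g : K ≃ₐ[k] K) :
    ∃ φ : AlgebraicClosure K →+* AlgebraicClosure K,
      ∀ a, φ (algebraMap K _ a) = algebraMap K _ (g a) :=
  ⟨IsAlgClosure.equivOfEquiv (AlgebraicClosure K) (AlgebraicClosure K) g.toRingEquiv,
    IsAlgClosure.equivOfEquiv_algebraMap _ _ g.toRingEquiv⟩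

theorem exists_map_addChar_eq {Ω : Type*} [Field Ω] {ζ : Ω} (hζ : IsPrimitiveRoot ζ 7)
    {ψ : AddChar (ZMod 7) Ω} (hψ : ψ 1 = ζ) (φ : Ω →+* Ω) :
    ∃ r r' : ZMod 7, r' * r = 1 ∧ ∀ t, φ (ψ t) = ψ (r * t) := by
  have hunit : ∀ a : ZMod 7, a ≠ 0 → ∃ a', a' * a = 1 := by decide
  have hpow (t : ZMod 7) : ψ t = ζ ^ t.val := by
    rw [← hψ, ← AddChar.map_nsmul_eq_pow, nsmul_one, ZMod.natCast_zmod_val]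
  obtain ⟨r, -, hr⟩ := hζ.eq_pow_of_pow_eq_one (ξ := φ ζ)
    (by rw [← map_pow, hζ.pow_eq_one, map_one])
  have hφ (t : ZMod 7) : φ (ψ t) = ψ (r * t) := by
    rw [hpow t, map_pow, ← hr, ← hψ, ← AddChar.map_nsmul_eq_pow, ← AddChar.map_nsmul_eq_pow,
      nsmul_one, nsmul_eq_mul, ZMod.natCast_zmod_val, mul_comm]
  obtain ⟨r', hr'⟩ := hunit r fun h0 => by
    have h1 := hφ 1
    rw [h0, zero_mul, AddChar.map_zero_eq_one, hψ, map_eq_one_iff φ φ.injective] at h1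
    exact hζ.ne_one (by norm_num) h1
  exact ⟨r, r', hr', hφ⟩

theorem exists_shift_invariant_family (h7 : (7 : K) ≠ 0) {x : ZMod 7 → K}
    (hx : AlgebraicIndependent k x) (hgen : adjoin k (Set.range x) = ⊤) :
    ∃ w : ZMod 7 → K,
      (∀ (g : K ≃ₐ[k] K) (u u' d : ZMod 7), u' * u = 1 → (∀ i, g (x i) = x (u * i + d)) →
        ∀ j, g (w j) = w (u * j)) ∧
      ∀ L : IntermediateField k K, (∀ j, w j ∈ L) → FiniteDimensional L K ∧ finrank L K ≤ 7 := by
  let Ω := AlgebraicClosure K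
  have h7Ω : ((7 : ℕ) : Ω) ≠ 0 := fun h => h7 <| (algebraMap K Ω).injective <| by
    rw [map_ofNat, map_zero]
    exact_mod_cast h
  have : NeZero ((7 : ℕ) : Ω) := ⟨h7Ω⟩
  obtain ⟨ζ, hζ⟩ := HasEnoughRootsOfUnity.exists_primitiveRoot Ω 7
  obtain ⟨ψ, hψ, hψ1⟩ : ∃ ψ : AddChar (ZMod 7) Ω, ψ.IsPrimitive ∧ ψ 1 = ζ :=
    ⟨_, AddChar.zmodChar_primitive_of_primitive_root 7 hζ, by
      rw [AddChar.zmodChar_apply]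
      exact pow_one ζ⟩
  have hX : AlgebraicIndependent k fun i => algebraMap K Ω (x i) :=
    hx.map' (f := IsScalarTower.toAlgHom k K Ω) (algebraMap K Ω).injective
  have hy (a : ZMod 7) := lagrangeSum_ne_zero (ψ := ψ) hX a
  have hrange (j : ZMod 7) : ratioTransform ψ (fun i => algebraMap K Ω (x i)) j
      ∈ Set.range (algebraMap K Ω) :=
    sum_mul_mem_range_algebraMap hψ
      (resolventRatio_mem_characterAlgebra (fun i => ⟨x i, rfl⟩) hy) j
  choose w hw using hrange
  refine ⟨w, fun g u u' d huu' hg j => ?_, fun L hL =>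
    finiteDimensional_and_finrank_le_of_ratioTransform_mem hψ h7 hgen hy hL hw⟩
  obtain ⟨φ, hφ⟩ := exists_ringHom_algebraMap_algebraicClosure g
  obtain ⟨r, r', hrr', hφψ⟩ := exists_map_addChar_eq hζ hψ1 φ
  apply (algebraMap K Ω).injective
  rw [← hφ, hw, hw]
  exact map_ratioTransform huu' hrr' hφψ (fun i => by rw [hφ, hg]) j

end ShiftInvariants

section CyclicCubic

variable {F K : Type*} [Field F] [Field K] [Algebra F K] {M : IntermediateField F K}

theorem mem_of_power_sums_mem {t₀ t₁ t₂ b₀ b₁ b₂ : K} (ht₀ : t₀ ∈ M) (ht₁ : t₁ ∈ M)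
    (ht₂ : t₂ ∈ M) (h₀₁ : t₀ ≠ t₁) (h₀₂ : t₀ ≠ t₂) (hs₀ : b₀ + b₁ + b₂ ∈ M)
    (hs₁ : t₀ * b₀ + t₁ * b₁ + t₂ * b₂ ∈ M)
    (hs₂ : t₀ ^ 2 * b₀ + t₁ ^ 2 * b₁ + t₂ ^ 2 * b₂ ∈ M) : b₀ ∈ M := by
  have h : b₀ = ((t₀ ^ 2 * b₀ + t₁ ^ 2 * b₁ + t₂ ^ 2 * b₂)
      - (t₁ + t₂) * (t₀ * b₀ + t₁ * b₁ + t₂ * b₂) + t₁ * t₂ * (b₀ + b₁ + b₂))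
      / ((t₀ - t₁) * (t₀ - t₂)) := by
    rw [eq_div_iff (mul_ne_zero (sub_ne_zero.mpr h₀₁) (sub_ne_zero.mpr h₀₂))]
    ring
  rw [h]
  exact div_mem (add_mem (sub_mem hs₂ (mul_mem (add_mem ht₁ ht₂) hs₁))
    (mul_mem (mul_mem ht₁ ht₂) hs₀)) (mul_mem (sub_mem ht₀ ht₁) (sub_mem ht₀ ht₂))

/-- If `n` is the sum of `t` and its images `-(1 + t) / t`, `-1 / (1 + t)` under a Möbius
transformation of order three, then `t` is a root of a monic cubic over `ℤ[n]`. -/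
theorem simplest_cubic_eq_zero {t : K} (ht : t ≠ 0) (ht1 : 1 + t ≠ 0) {n : K}
    (hn : n = t + -(1 + t) / t + -1 / (1 + t)) : t ^ 3 - n * t ^ 2 - (n + 3) * t - 1 = 0 := by
  rw [hn]
  field_simp
  ring

theorem mem_of_weighted_sums_mem {t a δ : K} (htM : t ∈ M) (ht : t ≠ 0) (ht1 : 1 + t ≠ 0)
    (hq : t ^ 2 + t + 1 ≠ 0) (hs₀ : a + (a - δ) + (a - δ - t * δ) ∈ M)
    (hs₁ : t * a + -(1 + t) / t * (a - δ) + -1 / (1 + t) * (a - δ - t * δ) ∈ M) :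
    a ∈ M ∧ δ ∈ M := by
  obtain ⟨s₀, hs₀'⟩ : ∃ s, s = a + (a - δ) + (a - δ - t * δ) := ⟨_, rfl⟩
  obtain ⟨s₁, hs₁'⟩ : ∃ s, s = t * a + -(1 + t) / t * (a - δ) + -1 / (1 + t) * (a - δ - t * δ) :=
    ⟨_, rfl⟩
  have ha : a = (s₀ * ((1 + (t + t)) * (1 + t)) + s₁ * ((1 + 1 + t) * (t * (1 + t))))
      / (t ^ 2 + t + 1) ^ 2 := by
    rw [eq_div_iff (pow_ne_zero 2 hq), hs₀', hs₁']
    field_simp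
    ring
  have hδ : δ = ((s₁ + s₁ + s₁) * (t * (1 + t)) - (t ^ 3 - t - t - t - 1) * s₀)
      / (t ^ 2 + t + 1) ^ 2 := by
    rw [eq_div_iff (pow_ne_zero 2 hq), hs₀', hs₁']
    field_simp
    ring
  rw [← hs₀'] at hs₀
  rw [← hs₁'] at hs₁
  have h1 : 1 + t ∈ M := add_mem (one_mem M) htM
  have hqM : (t ^ 2 + t + 1) ^ 2 ∈ M :=
    pow_mem (add_mem (add_mem (pow_mem htM 2) htM) (one_mem M)) 2
  constructor
  · rw [ha]
    exact div_mem (add_mem (mul_mem hs₀ (mul_mem (add_mem (one_mem M) (add_mem htM htM)) h1))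
      (mul_mem hs₁ (mul_mem (add_mem (add_mem (one_mem M) (one_mem M)) htM) (mul_mem htM h1)))) hqM
  · rw [hδ]
    exact div_mem (sub_mem (mul_mem (add_mem (add_mem hs₁ hs₁) hs₁) (mul_mem htM h1))
      (mul_mem (sub_mem (sub_mem (sub_mem (sub_mem (pow_mem htM 3) htM) htM) htM) (one_mem M)) hs₀))
      hqM

end CyclicCubic

section CharNeSeven

variable {k K : Type*} [Field k] [Field K] [Algebra k K]

theorem differences_ne_zero {w : ZMod 7 → K} (hw : AlgebraicIndependent k w) :
    w 1 - w 2 ≠ 0 ∧ w 2 - w 4 ≠ 0 ∧ w 4 - w 1 ≠ 0 ∧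
      (w 2 - w 4) ^ 2 + (w 2 - w 4) * (w 1 - w 2) + (w 1 - w 2) ^ 2 ≠ 0 := by
  have h12 : (1 : ZMod 7) ≠ 2 := by decide
  have h24 : (2 : ZMod 7) ≠ 4 := by decide
  have h41 : (4 : ZMod 7) ≠ 1 := by decide
  refine ⟨sub_ne_zero.mpr (hw.injective.ne h12), sub_ne_zero.mpr (hw.injective.ne h24),
    sub_ne_zero.mpr (hw.injective.ne h41), fun h => ?_⟩
  open MvPolynomial in
  have h0 := hw.eq_zero_of_aeval_eq_zero
    ((X 2 - X 4) ^ 2 + (X 2 - X 4) * (X 1 - X 2) + (X 1 - X 2) ^ 2) (by simpa using h)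
  have h1 := congrArg (MvPolynomial.eval fun i => if i = 1 then (1 : k) else 0) h0
  simp [h12.symm, h41] at h1

theorem isRationalExtension_of_seven_ne_zero (h7 : (7 : K) ≠ 0) {x : ZMod 7 → K}
    (hx : AlgebraicIndependent k x) (hgen : adjoin k (Set.range x) = ⊤) {σ τ : K ≃ₐ[k] K}
    (hσ : ∀ i, σ (x i) = x (i + 1)) (hτ : ∀ i, τ (x i) = x (2 * i)) :
    IsRationalExtension k (fixedField (Subgroup.closure {σ, τ})) := by
  have hτw' : (4 : ZMod 7) * 2 = 1 := by decide
  obtain ⟨w, hw, hfin⟩ := exists_shift_invariant_family h7 hx hgen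
  have hσw (j : ZMod 7) : σ (w j) = w j := by
    simpa using hw σ 1 1 1 (one_mul 1) (by simpa using hσ) j
  have hτw (j : ZMod 7) : τ (w j) = w (2 * j) :=
    hw τ 2 4 0 hτw' (by simpa using hτ) j
  have hwind : AlgebraicIndependent k w := by
    have := (hfin (adjoin k (Set.range w)) fun j => subset_adjoin k _ ⟨j, rfl⟩).1
    exact algebraicIndependent_of_finiteDimensional_adjoin hx rfl
  obtain ⟨hd₀, hd₁, hd₂, hq⟩ := differences_ne_zero hwind
  obtain ⟨t, ht⟩ : ∃ t, t = (w 2 - w 4) / (w 1 - w 2) := ⟨_, rfl⟩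
  obtain ⟨t', ht'⟩ : ∃ t, t = (w 4 - w 1) / (w 2 - w 4) := ⟨_, rfl⟩
  obtain ⟨t'', ht''⟩ : ∃ t, t = (w 1 - w 2) / (w 4 - w 1) := ⟨_, rfl⟩
  have htd : w 2 - w 4 = t * (w 1 - w 2) := by rw [ht, div_mul_cancel₀ _ hd₀]
  have htd' : w 4 - w 1 = -(1 + t) * (w 1 - w 2) := by linear_combination -htd
  have ht0 : t ≠ 0 := ht ▸ div_ne_zero hd₁ hd₀
  have ht1 : 1 + t ≠ 0 := fun h => hd₂ (by rw [htd', h, neg_zero, zero_mul])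
  have htq : t ^ 2 + t + 1 ≠ 0 := fun h => hq <| by
    rw [htd]
    linear_combination (w 1 - w 2) ^ 2 * h
  have ht'_eq : t' = -(1 + t) / t := by
    rw [ht', htd', htd, mul_div_mul_right _ _ hd₀]
  have ht''_eq : t'' = -1 / (1 + t) := by
    rw [ht'', htd', neg_mul, div_neg, div_mul_cancel_right₀ hd₀, neg_div, one_div]
  let T : Fin 7 → K := ![w 0, t + t' + t'', w 1 + w 2 + w 4, t * w 1 + t' * w 2 + t'' * w 4,
    w 3 + w 6 + w 5, t * w 3 + t' * w 6 + t'' * w 5,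
    t ^ 2 * w 3 + t' ^ 2 * w 6 + t'' ^ 2 * w 5]
  let F := adjoin k (Set.range T)
  have hTF (i : Fin 7) : T i ∈ F := subset_adjoin k _ ⟨i, rfl⟩
  have hTM (i : Fin 7) : T i ∈ F⟮t⟯ := _root_.algebraMap_mem F⟮t⟯ (⟨T i, hTF i⟩ : F)
  have htM : t ∈ F⟮t⟯ := mem_adjoin_simple_self F t
  have h1M : 1 + t ∈ F⟮t⟯ := add_mem (one_mem _) htM
  have ht'M : t' ∈ F⟮t⟯ := ht'_eq ▸ div_mem (neg_mem h1M) htM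
  have ht''M : t'' ∈ F⟮t⟯ := ht''_eq ▸ div_mem (neg_mem (one_mem _)) h1M
  have hw2 : w 2 = w 1 - (w 1 - w 2) := by ring
  have hw4 : w 4 = w 1 - (w 1 - w 2) - t * (w 1 - w 2) := by linear_combination -htd
  obtain ⟨hw1M, hδM⟩ : w 1 ∈ F⟮t⟯ ∧ w 1 - w 2 ∈ F⟮t⟯ := by
    refine mem_of_weighted_sums_mem htM ht0 ht1 htq ?_ ?_
    · rw [← hw4, ← hw2]
      exact hTM 2
    · rw [← hw4, ← hw2, ← ht'_eq, ← ht''_eq]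
      exact hTM 3
  have h01 : t ≠ t' := fun h => htq <| by
    rw [ht'_eq, eq_div_iff ht0] at h
    linear_combination h
  have h02 : t ≠ t'' := fun h => htq <| by
    rw [ht''_eq, eq_div_iff ht1] at h
    linear_combination h
  have h12 : t' ≠ t'' := fun h => htq <| by
    rw [ht'_eq, ht''_eq, div_eq_div_iff ht0 ht1] at h
    linear_combination -h
  have hwM (j : ZMod 7) : w j ∈ F⟮t⟯ := by
    fin_cases j
    · exact hTM 0
    · exact hw1M
    · exact hw2 ▸ sub_mem hw1M hδM
    · exact mem_of_power_sums_mem htM ht'M ht''M h01 h02 (hTM 4) (hTM 5) (hTM 6)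
    · exact hw4 ▸ sub_mem (sub_mem hw1M hδM) (mul_mem htM hδM)
    · refine mem_of_power_sums_mem ht''M htM ht'M h02.symm h12.symm (b₁ := w 3) (b₂ := w 6) ?_ ?_ ?_
      · convert hTM 4 using 1
        change w 5 + _ + _ = w 3 + w 6 + w 5
        ring
      · convert hTM 5 using 1
        change _ * w 5 + _ + _ = t * w 3 + t' * w 6 + t'' * w 5
        ring
      · convert hTM 6 using 1
        change _ * w 5 + _ + _ = t ^ 2 * w 3 + t' ^ 2 * w 6 + t'' ^ 2 * w 5
        ring
    · refine mem_of_power_sums_mem ht'M htM ht''M h01.symm h12 (b₁ := w 3) (b₂ := w 5) ?_ ?_ ?_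
      · convert hTM 4 using 1
        change w 6 + _ + _ = w 3 + w 6 + w 5
        ring
      · convert hTM 5 using 1
        change _ * w 6 + _ + _ = t * w 3 + t' * w 6 + t'' * w 5
        ring
      · convert hTM 6 using 1
        change _ * w 6 + _ + _ = t ^ 2 * w 3 + t' ^ 2 * w 6 + t'' ^ 2 * w 5
        ring
  obtain ⟨hMK, hMKle⟩ : FiniteDimensional F⟮t⟯ K ∧ finrank F⟮t⟯ K ≤ 7 :=
    hfin (F⟮t⟯.restrictScalars k) hwM
  let n : F := ⟨T 1, hTF 1⟩
  obtain ⟨hFM, hFMle⟩ := finiteDimensional_and_finrank_le_of_adjoin_simple (u := t)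
    (p := Polynomial.X ^ 3 - Polynomial.C n * Polynomial.X ^ 2
      - (Polynomial.C n + 3) * Polynomial.X - 1) (by monicity!)
    (by
      simpa [n, T, map_ofNat] using simplest_cubic_eq_zero ht0 ht1 (n := T 1)
        (by simp [T, ht'_eq, ht''_eq]))
  have hdeg : (Polynomial.X ^ 3 - Polynomial.C n * Polynomial.X ^ 2
      - (Polynomial.C n + 3) * Polynomial.X - 1).natDegree ≤ 3 := by compute_degree
  have : FiniteDimensional F K := FiniteDimensional.trans F F⟮t⟯ K
  have : Free F F⟮t⟯ := Free.of_divisionRing F F⟮t⟯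
  have : Free F⟮t⟯ K := Free.of_divisionRing F⟮t⟯ K
  have hle : finrank F K ≤ 21 := by
    rw [← finrank_mul_finrank F F⟮t⟯ K]
    exact Nat.mul_le_mul (hFMle.trans hdeg) hMKle
  refine isRationalExtension_fixedField hx hgen hσ hτ T (fun i => ?_) (fun i => ?_) hle
  · have hσt : σ t = t := by simp [ht, hσw]
    have hσt' : σ t' = t' := by simp [ht', hσw]
    have hσt'' : σ t'' = t'' := by simp [ht'', hσw]
    fin_cases i <;> simp [T, hσw, hσt, hσt', hσt'']
  · have h0 : τ (w 0) = w 0 := hτw 0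
    have h1 : τ (w 1) = w 2 := hτw 1
    have h2 : τ (w 2) = w 4 := hτw 2
    have h3 : τ (w 3) = w 6 := hτw 3
    have h4 : τ (w 4) = w 1 := hτw 4
    have h5 : τ (w 5) = w 3 := hτw 5
    have h6 : τ (w 6) = w 5 := hτw 6
    have hτt : τ t = t' := by simp [ht, ht', h1, h2, h4]
    have hτt' : τ t' = t'' := by simp [ht', ht'', h1, h2, h4]
    have hτt'' : τ t'' = t := by simp [ht'', ht, h1, h2, h4]
    fin_cases i <;> simp [T, h0, h1, h2, h3, h4, h5, h6, hτt, hτt', hτt''] <;> ring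

end CharNeSeven

/-- The fixed field of `G₂₁ = ⟨σ, τ²⟩` with `σ : xᵢ ↦ x_{i+1}`, `τ² : xᵢ ↦ x_{2i}` (indices mod 7) acting on the rational function field in 7 variables is purely transcendental over any field `k`. -/
theorem G21_fixed_field_rational
    (k K : Type*) [Field k] [Field K] [Algebra k K]
    (x : ZMod 7 → K) (hx : AlgebraicIndependent k x)
    (hgen : IntermediateField.adjoin k (Set.range x) = ⊤)
    (σ τ : K ≃ₐ[k] K)
    (hσ : ∀ i : ZMod 7, σ (x i) = x (i + 1))
    (hτ : ∀ i : ZMod 7, τ (x i) = x (2 * i)) :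
    IsRationalExtension k
      (IntermediateField.fixedField (Subgroup.closure {σ, τ})) := by
  by_cases h7 : (7 : K) = 0
  · have : CharP K 7 := ringChar.of_eq
      (CharP.ringChar_of_prime_eq_zero (by norm_num) (by exact_mod_cast h7))
    have : CharP k 7 := (algebraMap k K).charP (algebraMap k K).injective 7
    exact isRationalExtension_of_charP_seven hx hgen hσ hτ
  · exact isRationalExtension_of_seven_ne_zero h7 hx hgen hσ hτ
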